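/- Let 𝒟 = 2^X. A probabilistic choice rule ρ has a FRUM representation if and only if q(a,F) ≥ 0 for all frames F and all a ∈ F, and y(a,F) ≥ 0 for all frames F and all a ∉ F. -/

import Mathlib

open Finset

/-- Frame-dependent utility: `u y + v y` if `y` is framed, `u y` otherwise. -/
noncomputable def UF {X : Type*} [DecidableEq X] (u v : X → ℝ) (F : Finset X) (y : X) : ℝ :=
  u y + (if y ∈ F then v y else 0)

/-- `c` admits a frame-dependent utility (FUM) representation. -/
def IsFUM {X : Type*} [Fintype X] [DecidableEq X] (c : Finset X → X) : Prop :=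
  ∃ u v : X → ℝ, (∀ x, 0 ≤ v x) ∧
    ∀ F : Finset X, Function.Injective (UF u v F) ∧ ∀ y : X, UF u v F y ≤ UF u v F (c F)

open Classical in
/-- `ρ` admits a frame-dependent random utility (FRUM) representation. -/
def IsFRUM {X : Type*} [Fintype X] [DecidableEq X] (ρ : X → Finset X → ℝ) : Prop :=
  ∃ μ : (Finset X → X) → ℝ, (∀ c, 0 ≤ μ c) ∧ (∀ c, ¬ IsFUM c → μ c = 0) ∧
    (∑ c : Finset X → X, μ c) = 1 ∧
    ∀ (x : X) (F : Finset X),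
      ρ x F = ∑ c ∈ Finset.univ.filter (fun c : Finset X → X => IsFUM c ∧ c F = x), μ c

/-- Block–Marschak polynomial for a framed alternative. -/
noncomputable def qBM {X : Type*} [Fintype X] [DecidableEq X]
    (ρ : X → Finset X → ℝ) (a : X) (F : Finset X) : ℝ :=
  ∑ B ∈ Finset.univ.filter (fun B => F ⊆ B), (-1 : ℝ) ^ (B \ F).card * ρ a B

/-- Auxiliary Block–Marschak polynomial for a non-framed alternative. -/
noncomputable def yBM {X : Type*} [Fintype X] [DecidableEq X]
    (ρ : X → Finset X → ℝ) (a : X) (F : Finset X) : ℝ :=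
  ∑ B ∈ Finset.univ.filter (fun B => F ⊆ B ∧ a ∉ B), (-1 : ℝ) ^ (B \ F).card * ρ a B

section

variable {X : Type*} [DecidableEq X]

lemma neg_one_pow_card_sdiff {F B C : Finset X} (hFB : F ⊆ B) (hBC : B ⊆ C) :
    (-1 : ℝ) ^ (C \ B).card = (-1) ^ (C \ F).card * (-1) ^ (B \ F).card := by
  have h : (C \ F).card = (C \ B).card + (B \ F).card := by
    rw [← card_union_of_disjoint (disjoint_of_subset_right sdiff_subset sdiff_disjoint),
      sdiff_union_sdiff_cancel hBC hFB]
  rw [h, pow_add, mul_assoc, ← mul_pow]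
  simp

variable [Fintype X]

/-- The signed indicator of an interval of sets sums to one if the interval is a point,
and to zero otherwise. -/
lemma sum_filter_Icc_neg_one_pow (F G : Finset X) :
    ∑ B ∈ univ.filter (fun B => F ⊆ B ∧ B ⊆ G), (-1 : ℝ) ^ (B \ F).card =
      if F = G then 1 else 0 := by
  by_cases hFG : F ⊆ G
  · have h : ∑ B ∈ univ.filter (fun B => F ⊆ B ∧ B ⊆ G), (-1 : ℝ) ^ (B \ F).card =
        ∑ D ∈ (G \ F).powerset, (-1 : ℝ) ^ D.card := by
      refine sum_bij' (fun B _ => B \ F) (fun D _ => D ∪ F) ?_ ?_ ?_ ?_ ?_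
      · intro B hB
        simp only [mem_filter, mem_univ, true_and] at hB
        exact mem_powerset.2 (sdiff_subset_sdiff hB.2 le_rfl)
      · intro D hD
        simp only [mem_filter, mem_univ, true_and]
        exact ⟨subset_union_right,
          union_subset ((mem_powerset.1 hD).trans sdiff_subset) hFG⟩
      · intro B hB
        simp only [mem_filter, mem_univ, true_and] at hB
        exact sdiff_union_of_subset hB.1
      · intro D hD
        exact union_sdiff_cancel_right
          (disjoint_of_subset_left (mem_powerset.1 hD) sdiff_disjoint)
      · intro B _
        rfl
    have h2 := congrArg (Int.cast : ℤ → ℝ) (sum_powerset_neg_one_pow_card (x := G \ F))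
    push_cast at h2
    rw [h, h2]
    have : G \ F = ∅ ↔ F = G := by
      rw [sdiff_eq_empty_iff_subset]
      exact ⟨fun h => hFG.antisymm h, fun h => h.symm.subset⟩
    simp [this]
  · rw [if_neg (fun h => hFG h.subset), filter_eq_empty_iff.2, sum_empty]
    rintro B - ⟨h1, h2⟩
    exact hFG (h1.trans h2)

lemma sum_filter_Icc_neg_one_pow' (F C : Finset X) :
    ∑ B ∈ univ.filter (fun B => F ⊆ B ∧ B ⊆ C), (-1 : ℝ) ^ (C \ B).card =
      if F = C then 1 else 0 := by
  rw [sum_congr rfl fun B hB => neg_one_pow_card_sdiff (mem_filter.1 hB).2.1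
    (mem_filter.1 hB).2.2, ← mul_sum, sum_filter_Icc_neg_one_pow]
  split_ifs with h
  · simp [h]
  · simp

/-- The Block–Marschak polynomials of framed and non-framed alternatives, in a single formula. -/
noncomputable def zBM (R : X → Finset X → ℝ) (a : X) (F : Finset X) : ℝ :=
  ∑ B ∈ univ.filter (fun B => F ⊆ B ∧ (a ∈ B → a ∈ F)), (-1 : ℝ) ^ (B \ F).card * R a B

lemma zBM_of_mem (R : X → Finset X → ℝ) {a : X} {F : Finset X} (h : a ∈ F) :
    zBM R a F = qBM R a F := by
  simp [zBM, qBM, h]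

lemma zBM_of_notMem (R : X → Finset X → ℝ) {a : X} {F : Finset X} (h : a ∉ F) :
    zBM R a F = yBM R a F := by
  simp [zBM, yBM, h]

lemma zBM_nonneg_iff (R : X → Finset X → ℝ) :
    (∀ a F, 0 ≤ zBM R a F) ↔
      ((∀ (F : Finset X) (a : X), a ∈ F → 0 ≤ qBM R a F) ∧
        (∀ (F : Finset X) (a : X), a ∉ F → 0 ≤ yBM R a F)) := by
  constructor
  · exact fun h => ⟨fun F a ha => zBM_of_mem R ha ▸ h a F,
      fun F a ha => zBM_of_notMem R ha ▸ h a F⟩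
  · rintro ⟨h1, h2⟩ a F
    by_cases ha : a ∈ F
    · exact zBM_of_mem R ha ▸ h1 F a ha
    · exact zBM_of_notMem R ha ▸ h2 F a ha

/-- Möbius inversion for the Block–Marschak polynomials. -/
lemma sum_zBM (R : X → Finset X → ℝ) (a : X) (F : Finset X) :
    ∑ B ∈ univ.filter (fun B => F ⊆ B ∧ (a ∈ B → a ∈ F)), zBM R a B = R a F := by
  have h : ∑ B ∈ univ.filter (fun B => F ⊆ B ∧ (a ∈ B → a ∈ F)), zBM R a B =
      ∑ C ∈ univ.filter (fun C => F ⊆ C ∧ (a ∈ C → a ∈ F)),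
        ∑ B ∈ univ.filter (fun B => F ⊆ B ∧ B ⊆ C), (-1 : ℝ) ^ (C \ B).card * R a C := by
    refine sum_comm' fun B C => ?_
    simp only [mem_filter, mem_univ, true_and]
    constructor
    · rintro ⟨⟨h1, h2⟩, h3, h4⟩
      exact ⟨⟨h1, h3⟩, h1.trans h3, fun h => h2 (h4 h)⟩
    · rintro ⟨⟨h1, h2⟩, h3, h4⟩
      exact ⟨⟨h1, fun h => h4 (h2 h)⟩, h2, fun h => h1 (h4 h)⟩
  rw [h]
  simp_rw [← sum_mul, sum_filter_Icc_neg_one_pow']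
  simp [ite_mul]

lemma sum_qBM {R : X → Finset X → ℝ} {t : ℝ} (hR : ∀ F, ∑ x, R x F = t) (F : Finset X) :
    ∑ a, qBM R a F = if F = univ then t else 0 := by
  have h := sum_filter_Icc_neg_one_pow F univ
  simp only [subset_univ, and_true] at h
  simp_rw [qBM]
  rw [sum_comm]
  simp_rw [← mul_sum, hR, ← sum_mul, h]
  simp

lemma yBM_eq_add {R : X → Finset X → ℝ} {a : X} {F : Finset X} (ha : a ∉ F) :
    yBM R a F = qBM R a F + qBM R a (insert a F) := by
  rw [qBM, ← sum_filter_add_sum_filter_not _ (fun B => a ∉ B), filter_filter, filter_filter,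
    yBM, add_assoc, left_eq_add, qBM]
  have h : univ.filter (fun B => F ⊆ B ∧ ¬ a ∉ B) = univ.filter (fun B => insert a F ⊆ B) := by
    ext B
    simp [insert_subset_iff, and_comm]
  rw [h, ← sum_add_distrib]
  refine sum_eq_zero fun B hB => ?_
  have hB' : insert a F ⊆ B := (mem_filter.1 hB).2
  have hc : (B \ F).card = (B \ insert a F).card + 1 := by
    rw [card_sdiff_of_subset hB', card_sdiff_of_subset ((subset_insert a F).trans hB'),
      card_insert_of_notMem ha]
    have := card_le_card hB'
    rw [card_insert_of_notMem ha] at this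
    omega
  rw [hc]
  ring

/-- Flow conservation for the Block–Marschak polynomials. -/
lemma sum_zBM_eq {R : X → Finset X → ℝ} {t : ℝ} (hR : ∀ F, ∑ x, R x F = t) (F : Finset X) :
    ∑ a, zBM R a F =
      (if F = univ then t else 0) + ∑ a ∈ univ.filter (· ∉ F), zBM R a (insert a F) := by
  rw [← sum_qBM hR, sum_filter, ← sum_add_distrib]
  refine sum_congr rfl fun a _ => ?_
  split_ifs with ha
  · rw [zBM_of_mem R ha, add_zero]
  · rw [zBM_of_notMem R ha, zBM_of_mem R (mem_insert_self a F), yBM_eq_add ha]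

/-- The stochastic choice rule degenerate at `c`. -/
def choiceIndicator (c : Finset X → X) (a : X) (F : Finset X) : ℝ :=
  if c F = a then 1 else 0

lemma zBM_choiceIndicator {c : Finset X → X} {a : X} {F G : Finset X} {P : Prop} [Decidable P]
    (h : ∀ B, F ⊆ B → (((a ∈ B → a ∈ F) ∧ c B = a) ↔ (P ∧ B ⊆ G))) :
    zBM (choiceIndicator c) a F = if P ∧ F = G then 1 else 0 := by
  have h1 : zBM (choiceIndicator c) a F =
      ∑ B ∈ univ.filter (fun B => P ∧ F ⊆ B ∧ B ⊆ G), (-1 : ℝ) ^ (B \ F).card := by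
    simp only [zBM, choiceIndicator, mul_ite, mul_one, mul_zero]
    rw [← sum_filter, filter_filter]
    refine sum_congr (filter_congr fun B _ => ?_) fun _ _ => rfl
    have := h B
    tauto
  rw [h1]
  by_cases hP : P
  · simp [hP, sum_filter_Icc_neg_one_pow]
  · simp [hP]

lemma zBM_choiceIndicator_of_mem {u v : X → ℝ} (hv : ∀ x, 0 ≤ v x) {c : Finset X → X}
    (hc : ∀ F : Finset X,
      Function.Injective (UF u v F) ∧ ∀ y : X, UF u v F y ≤ UF u v F (c F))
    {a : X} {F : Finset X} (ha : a ∈ F) [Decidable (∀ y, y ≠ a → u y < u a + v a)] :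
    zBM (choiceIndicator c) a F =
      if (∀ y, y ≠ a → u y < u a + v a) ∧ F = univ.filter (fun y => u y + v y ≤ u a + v a)
      then 1 else 0 := by
  refine zBM_choiceIndicator fun B hB => ?_
  have haB := hB ha
  simp only [ha, implies_true, true_and]
  constructor
  · rintro rfl
    refine ⟨fun y hy => ?_, fun y hy => ?_⟩
    · have h1 := (hc B).2 y
      have h2 : UF u v B y ≠ UF u v B (c B) := fun h => hy ((hc B).1 h)
      have h3 := lt_of_le_of_ne h1 h2
      have := hv y
      simp only [UF, haB, if_true] at h3
      split_ifs at h3 <;> linarith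
    · have h1 := (hc B).2 y
      simpa [UF, haB, hy] using h1
  · rintro ⟨h1, h2⟩
    by_contra hne
    have h3 := (hc B).2 a
    have h4 : UF u v B a ≠ UF u v B (c B) := fun h => hne ((hc B).1 h).symm
    have h5 := lt_of_le_of_ne h3 h4
    simp only [UF, haB, if_true] at h5
    split_ifs at h5 with h6
    · have := (mem_filter.1 (h2 h6)).2
      linarith
    · have := h1 _ hne
      linarith

lemma zBM_choiceIndicator_of_notMem {u v : X → ℝ} (hv : ∀ x, 0 ≤ v x) {c : Finset X → X}
    (hc : ∀ F : Finset X,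
      Function.Injective (UF u v F) ∧ ∀ y : X, UF u v F y ≤ UF u v F (c F))
    {a : X} {F : Finset X} (ha : a ∉ F) [Decidable (∀ y, u y ≤ u a)] :
    zBM (choiceIndicator c) a F =
      if (∀ y, u y ≤ u a) ∧ F = univ.filter (fun y => u y + v y < u a) then 1 else 0 := by
  refine zBM_choiceIndicator fun B hB => ?_
  simp only [ha, imp_false]
  constructor
  · rintro ⟨haB, rfl⟩
    refine ⟨fun y => ?_, fun y hy => ?_⟩
    · have h1 := (hc B).2 y
      have := hv y
      simp only [UF, haB, if_false] at h1
      split_ifs at h1 <;> linarith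
    · have h1 := (hc B).2 y
      have h2 : UF u v B y ≠ UF u v B (c B) := fun h => haB ((hc B).1 h ▸ hy)
      have h3 := lt_of_le_of_ne h1 h2
      simpa [UF, haB, hy] using h3
  · rintro ⟨h1, h2⟩
    have haB : a ∉ B := fun h => by
      have := (mem_filter.1 (h2 h)).2
      linarith [hv a]
    refine ⟨haB, ?_⟩
    by_contra hne
    have h3 := (hc B).2 a
    have h4 : UF u v B a ≠ UF u v B (c B) := fun h => hne ((hc B).1 h).symm
    have h5 := lt_of_le_of_ne h3 h4
    simp only [UF, haB, if_false] at h5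
    split_ifs at h5 with h6
    · have := (mem_filter.1 (h2 h6)).2
      linarith
    · have := h1 (c B)
      linarith

lemma zBM_choiceIndicator_eq_zero_or_one {c : Finset X → X} (hc : IsFUM c) (a : X)
    (F : Finset X) : zBM (choiceIndicator c) a F = 0 ∨ zBM (choiceIndicator c) a F = 1 := by
  classical
  obtain ⟨u, v, hv, hc⟩ := hc
  by_cases ha : a ∈ F
  · rw [zBM_choiceIndicator_of_mem hv hc ha]
    split_ifs <;> simp
  · rw [zBM_choiceIndicator_of_notMem hv hc ha]
    split_ifs <;> simp

/-- A positive flow can be followed from the frame `F` until it leaves the system: `w` ranks the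
alternatives that are passed, in decreasing order, and `d` is the alternative at the exit. -/
lemma exists_ranking {R : X → Finset X → ℝ} {t : ℝ} (hR : ∀ F, ∑ x, R x F = t)
    (hz : ∀ a F, 0 ≤ zBM R a F) (F : Finset X) (hF : 0 < ∑ a, zBM R a F) :
    ∃ (w : X → ℕ) (d : X), (∀ x, x ∉ F → w x = 0) ∧ (∀ x y, 0 < w x → w x = w y → x = y) ∧
      (d ∈ F → 0 < w d) ∧
      (∀ a, 0 < w a → 0 < zBM R a (F.filter (fun y => w y ≤ w a))) ∧
      0 < zBM R d (F.filter (fun y => w y = 0)) := by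
  induction F using Finset.strongInduction with
  | H F ih =>
  obtain ⟨b, -, hb⟩ := exists_lt_of_sum_lt (by simpa using hF : ∑ _a : X, (0 : ℝ) < _)
  by_cases hbF : b ∈ F
  · have hpos : 0 < ∑ a, zBM R a (F.erase b) := by
      rw [sum_zBM_eq hR, if_neg ((erase_ssubset hbF).trans_subset (subset_univ F)).ne, zero_add]
      refine hb.trans_le ?_
      have := single_le_sum (f := fun a => zBM R a (insert a (F.erase b)))
        (s := univ.filter (· ∉ F.erase b)) (fun a _ => hz _ _) (a := b) (by simp)
      simpa [insert_erase hbF] using this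
    obtain ⟨w, d, h1, h2, h3, h4, h5⟩ := ih _ (erase_ssubset hbF) hpos
    set m := univ.sup w + 1 with hm
    have hlt : ∀ x, w x < m := fun x => Nat.lt_succ_of_le (le_sup (mem_univ x))
    have hwb : w b = 0 := h1 b (by simp)
    refine ⟨Function.update w b m, d, ?_, ?_, ?_, ?_, ?_⟩
    · intro x hx
      rw [Function.update_of_ne (show x ≠ b from fun h => hx (h ▸ hbF))]
      exact h1 x (fun h => hx (mem_of_mem_erase h))
    · intro x y hx hxy
      have hx' := hlt x
      have hy' := hlt y
      simp only [Function.update_apply] at hx hxy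
      split_ifs at hx hxy with e1 e2 e2
      · rw [e1, e2]
      · omega
      · omega
      · exact h2 x y hx hxy
    · intro hd
      rcases eq_or_ne d b with rfl | hdb
      · simp [hm]
      · rw [Function.update_of_ne hdb]
        exact h3 (mem_erase.2 ⟨hdb, hd⟩)
    · intro a ha
      rcases eq_or_ne a b with rfl | hab
      · rw [filter_true_of_mem]
        · exact hb
        · intro y _
          simp only [Function.update_apply, if_true]
          split_ifs
          · exact le_rfl
          · exact (hlt y).le
      · rw [Function.update_of_ne hab] at ha ⊢
        convert h4 a ha using 2
        ext y
        have := hlt a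
        simp only [mem_filter, mem_erase, Function.update_apply]
        split_ifs with hy
        · simp only [hy, ne_eq, not_true, false_and, iff_false]
          omega
        · simp [hy]
    · convert h5 using 2
      ext y
      simp only [mem_filter, mem_erase, Function.update_apply]
      split_ifs with hy
      · simp [hy]
      · simp [hy]
  · exact ⟨fun _ => 0, b, by simp, by simp, fun h => absurd h hbF, by simp, by simpa using hb⟩

/-- A nonzero flow dominates a multiple of the flow of some deterministic rule. -/
lemma exists_isFUM_zBM_pos {R : X → Finset X → ℝ} {t : ℝ} (hR : ∀ F, ∑ x, R x F = t)
    (hz : ∀ a F, 0 ≤ zBM R a F) (ht : 0 < t) :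
    ∃ c : Finset X → X, IsFUM c ∧
      (∀ a F, zBM (choiceIndicator c) a F ≠ 0 → 0 < zBM R a F) ∧
      ∃ a F, zBM (choiceIndicator c) a F ≠ 0 := by
  classical
  have hpos : 0 < ∑ a, zBM R a univ := by
    rw [sum_zBM_eq hR]
    simpa using ht
  obtain ⟨w, d, -, hinj, hd, hq, hy⟩ := exists_ranking hR hz univ hpos
  have hwd : 0 < w d := hd (mem_univ d)
  have : Nonempty X := ⟨d⟩
  set u : X → ℝ := fun x => if x = d then 0 else -1 - ((Fintype.equivFin X x : ℕ) : ℝ) with hu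
  set v : X → ℝ := fun x => if 0 < w x then (w x : ℝ) - u x else 0 with hv
  have hud : u d = 0 := by simp [hu]
  have huneg : ∀ x, x ≠ d → u x < 0 := fun x hx => by
    have : (0 : ℝ) ≤ ((Fintype.equivFin X x : ℕ) : ℝ) := Nat.cast_nonneg _
    simp only [hu, if_neg hx]
    linarith
  have hule : ∀ x, u x ≤ 0 := fun x => by
    rcases eq_or_ne x d with rfl | hx
    · exact hud.le
    · exact (huneg x hx).le
  have huinj : Function.Injective u := by
    intro x y hxy
    rcases eq_or_ne x d with hx | hx <;> rcases eq_or_ne y d with hy | hy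
    · rw [hx, hy]
    · have := huneg y hy
      rw [← hxy, hx, hud] at this
      exact absurd this (lt_irrefl _)
    · have := huneg x hx
      rw [hxy, hy, hud] at this
      exact absurd this (lt_irrefl _)
    · simp only [hu, if_neg hx, if_neg hy, sub_right_inj, Nat.cast_inj] at hxy
      exact (Fintype.equivFin X).injective (Fin.ext hxy)
  have hv0 : ∀ x, 0 ≤ v x := fun x => by
    simp only [hv]
    split_ifs
    · have : (0 : ℝ) ≤ w x := Nat.cast_nonneg _
      linarith [hule x]
    · exact le_rfl
  have hs : ∀ x, u x + v x = if 0 < w x then (w x : ℝ) else u x := fun x => by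
    simp only [hv]
    split_ifs <;> ring
  have hU : ∀ F x, UF u v F x = if x ∈ F ∧ 0 < w x then (w x : ℝ) else u x := fun F x => by
    by_cases hx : x ∈ F
    · simp [UF, hx, hs]
    · simp [UF, hx]
  have hUinj : ∀ F, Function.Injective (UF u v F) := by
    intro F x y hxy
    rw [hU, hU] at hxy
    split_ifs at hxy with h1 h2 h2
    · exact hinj x y h1.2 (by exact_mod_cast hxy)
    · have : (0 : ℝ) < w x := by exact_mod_cast h1.2
      linarith [hule y]
    · have : (0 : ℝ) < w y := by exact_mod_cast h2.2
      linarith [hule x]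
    · exact huinj hxy
  choose c hc using fun F => Finite.exists_max (UF u v F)
  have hrep : ∀ F : Finset X,
      Function.Injective (UF u v F) ∧ ∀ y : X, UF u v F y ≤ UF u v F (c F) :=
    fun F => ⟨hUinj F, hc F⟩
  refine ⟨c, ⟨u, v, hv0, hrep⟩, ?_, ?_⟩
  · intro a F hne
    by_cases ha : a ∈ F
    · rw [zBM_choiceIndicator_of_mem hv0 hrep ha] at hne
      obtain ⟨h1, rfl⟩ := of_not_not fun h => hne (if_neg h)
      have hwa : 0 < w a := by
        by_contra hwa
        rcases eq_or_ne a d with rfl | had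
        · exact hwa hwd
        · have := h1 d had.symm
          rw [hs, if_neg hwa, hud] at this
          linarith [hule a]
      convert hq a hwa using 2
      refine filter_congr fun y _ => ?_
      rw [hs, hs, if_pos hwa]
      split_ifs with hwy
      · exact Nat.cast_le
      · have : (0 : ℝ) < w a := by exact_mod_cast hwa
        exact iff_of_true (by linarith [hule y]) (by omega)
    · rw [zBM_choiceIndicator_of_notMem hv0 hrep ha] at hne
      obtain ⟨h1, rfl⟩ := of_not_not fun h => hne (if_neg h)
      obtain rfl : a = d := by
        by_contra had
        have := huneg a had
        linarith [h1 d]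
      convert hy using 2
      refine filter_congr fun y _ => ?_
      rw [hs, hud]
      split_ifs with hwy
      · exact iff_of_false (not_lt.2 (Nat.cast_nonneg _)) (by omega)
      · exact iff_of_true (huneg y fun h => hwy (h ▸ hwd)) (by omega)
  · refine ⟨d, univ.filter (fun y => u y + v y < u d), ?_⟩
    rw [zBM_choiceIndicator_of_notMem hv0 hrep, if_pos]
    · exact one_ne_zero
    · exact ⟨fun y => hud ▸ hule y, rfl⟩
    · simp [hv0 d]

lemma zBM_sub_smul (R S : X → Finset X → ℝ) (r : ℝ) (a : X) (F : Finset X) :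
    zBM (fun x B => R x B - r * S x B) a F = zBM R a F - r * zBM S a F := by
  simp only [zBM]
  rw [mul_sum, ← sum_sub_distrib]
  exact sum_congr rfl fun B _ => by ring

lemma zBM_sum_smul {ι : Type*} (s : Finset ι) (μ : ι → ℝ) (S : ι → X → Finset X → ℝ) (a : X)
    (F : Finset X) :
    zBM (fun x B => ∑ i ∈ s, μ i * S i x B) a F = ∑ i ∈ s, μ i * zBM (S i) a F := by
  simp only [zBM, mul_sum]
  rw [sum_comm]
  exact sum_congr rfl fun i _ => sum_congr rfl fun B _ => by ring

lemma sum_choiceIndicator (c : Finset X → X) (F : Finset X) :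
    ∑ x, choiceIndicator c x F = 1 := by
  simp [choiceIndicator]

/-- A nonnegative flow is a conic combination of the flows of deterministic rules. -/
lemma exists_conic_combination {R : X → Finset X → ℝ} {t : ℝ} (hR : ∀ F, ∑ x, R x F = t)
    (hz : ∀ a F, 0 ≤ zBM R a F) :
    ∃ μ : (Finset X → X) → ℝ, (∀ c, 0 ≤ μ c) ∧ (∀ c, ¬ IsFUM c → μ c = 0) ∧
      ∀ x F, R x F = ∑ c, μ c * choiceIndicator c x F := by
  classical
  induction hn : (univ.filter fun p : X × Finset X => zBM R p.1 p.2 ≠ 0).card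
    using Nat.strong_induction_on generalizing R t with
  | h n ih =>
  rcases le_or_gt t 0 with ht | ht
  · have hnn : ∀ x F, 0 ≤ R x F := fun x F => by
      rw [← sum_zBM R x F]
      exact sum_nonneg fun B _ => hz x B
    refine ⟨fun _ => 0, fun _ => le_rfl, fun _ _ => rfl, fun x F => ?_⟩
    have := single_le_sum (f := fun x => R x F) (fun x _ => hnn x F) (mem_univ x)
    rw [hR] at this
    simpa using le_antisymm (this.trans ht) (hnn x F)
  · obtain ⟨c, hc, hcR, a₀, F₀, hne⟩ := exists_isFUM_zBM_pos hR hz ht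
    obtain ⟨p, hp, hmin⟩ := exists_min_image
      (univ.filter fun p : X × Finset X => zBM (choiceIndicator c) p.1 p.2 ≠ 0)
      (fun p => zBM R p.1 p.2) ⟨(a₀, F₀), by simpa using hne⟩
    simp only [mem_filter, mem_univ, true_and] at hp hmin
    set r := zBM R p.1 p.2 with hr
    have hr0 : 0 < r := hcR _ _ hp
    set R' : X → Finset X → ℝ := fun x B => R x B - r * choiceIndicator c x B with hR'
    have hz' : ∀ a F, zBM R' a F = zBM R a F - r * zBM (choiceIndicator c) a F :=
      fun a F => zBM_sub_smul R _ r a F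
    have h01 := zBM_choiceIndicator_eq_zero_or_one hc
    have hcard : (univ.filter fun p : X × Finset X => zBM R' p.1 p.2 ≠ 0).card < n := by
      rw [← hn]
      refine card_lt_card (ssubset_iff_of_subset ?_ |>.2 ⟨p, ?_, ?_⟩)
      · intro x hx
        simp only [mem_filter, mem_univ, true_and] at hx ⊢
        rcases h01 x.1 x.2 with h | h
        · simpa [hz', h] using hx
        · exact (hcR x.1 x.2 (by simp [h])).ne'
      · simpa using hr0.ne'
      · simp [hz', (h01 p.1 p.2).resolve_left hp, hr]
    obtain ⟨μ, h1, h2, h3⟩ := ih _ hcard (R := R') (t := t - r)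
      (fun F => by simp [hR', sum_sub_distrib, hR, ← mul_sum, sum_choiceIndicator])
      (fun a F => by
        rw [hz']
        rcases h01 a F with h | h
        · simpa [h] using hz a F
        · have := hmin (a, F) (by simp [h])
          simpa [h] using this) rfl
    refine ⟨fun c' => μ c' + if c' = c then r else 0, fun c' => ?_, fun c' hc' => ?_,
      fun x F => ?_⟩
    · have := h1 c'
      dsimp only
      split_ifs <;> linarith
    · simp [h2 c' hc', show c' ≠ c from fun h => hc' (h ▸ hc)]
    · have := h3 x F
      simp only [add_mul, sum_add_distrib, ← this, ite_mul, zero_mul, hR']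
      simp

open Classical in
lemma sum_filter_isFUM {μ : (Finset X → X) → ℝ} (hμ : ∀ c, ¬ IsFUM c → μ c = 0) (x : X)
    (F : Finset X) :
    ∑ c ∈ univ.filter (fun c : Finset X → X => IsFUM c ∧ c F = x), μ c =
      ∑ c, μ c * choiceIndicator c x F := by
  rw [sum_filter]
  refine sum_congr rfl fun c _ => ?_
  by_cases hc : IsFUM c
  · simp [hc, choiceIndicator]
  · simp [hc, hμ c hc]

end

/-- Characterization of FRUM: a probabilistic choice rule has a FRUM
representation iff the BM and auxiliary BM polynomials are non-negative. -/
theorem frum_characterization {X : Type*} [Fintype X] [DecidableEq X]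
    (ρ : X → Finset X → ℝ)
    (hpos : ∀ (x : X) (F : Finset X), 0 ≤ ρ x F)
    (hsum : ∀ F : Finset X, ∑ x, ρ x F = 1) :
    IsFRUM ρ ↔
      ((∀ (F : Finset X) (a : X), a ∈ F → 0 ≤ qBM ρ a F) ∧
        (∀ (F : Finset X) (a : X), a ∉ F → 0 ≤ yBM ρ a F)) := by
  rw [← zBM_nonneg_iff]
  constructor
  · rintro ⟨μ, h0, hμ, -, hρ⟩ a F
    have h : ρ = fun x B => ∑ c, μ c * choiceIndicator c x B := by
      funext x B
      rw [hρ, sum_filter_isFUM hμ]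
    rw [h, zBM_sum_smul]
    refine sum_nonneg fun c _ => ?_
    by_cases hc : IsFUM c
    · refine mul_nonneg (h0 c) ?_
      rcases zBM_choiceIndicator_eq_zero_or_one hc a F with h | h <;> simp [h]
    · simp [hμ c hc]
  · intro hz
    obtain ⟨μ, h0, hμ, hρ⟩ := exists_conic_combination hsum hz
    refine ⟨μ, h0, hμ, ?_, fun x F => by rw [hρ, sum_filter_isFUM hμ]⟩
    have h := hsum ∅
    simp_rw [hρ] at h
    rw [sum_comm] at h
    simpa [← mul_sum, sum_choiceIndicator] using h
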